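/- Let π be a permutation of {1, …, T} drawn uniformly at random, and run K epochs of incremental gradient descent with constant step size η, processing the components in the order f_{π(1)}, …, f_{π(T)} in every epoch (shuffle-once). Let α, β > 0 satisfy 1/α + 1/β ≤ 1/2 and η ≤ 1/(√β·T·L). Then the expectation over π of the last-iterate gap satisfies E[f(x_K) − f(x_*)] ≤ e·η²·T²·σ_*²·L·(1 + β/α)·K^{(α/β)/(1+α/β)} + e·‖x_0 − x_*‖²/(2·T·η·K^{1/(1+α/β)}). -/

import Mathlib

open Finset

section helpers

set_option linter.unusedSectionVars false

variable {E : Type*} [NormedAddCommGroup E] [InnerProductSpace ℝ E]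

lemma igd_line_deriv [CompleteSpace E] (f : E → ℝ) (g : E → E)
    (hgrad : ∀ x, HasGradientAt f (g x) x) (x v : E) (t : ℝ) :
    HasDerivAt (fun s : ℝ => f (x + s • v)) (inner ℝ (g (x + t • v)) v) t := by
  have h1 : HasDerivAt (fun s : ℝ => x + s • v) v t := by
    have := ((hasDerivAt_id t).smul_const v).const_add x
    simpa using this
  have h2 := (hgrad (x + t • v)).hasFDerivAt.comp_hasDerivAt t h1
  exact h2.congr_deriv (by simp)

lemma igd_first_order [CompleteSpace E] (f : E → ℝ) (g : E → E)
    (hconv : ConvexOn ℝ Set.univ f)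
    (hgrad : ∀ x, HasGradientAt f (g x) x) (x y : E) :
    f x + inner ℝ (g x) (y - x) ≤ f y := by
  have hd := igd_line_deriv f g hgrad x (y - x) 0
  have hc : ConvexOn ℝ Set.univ (fun s : ℝ => f (x + s • (y - x))) := by
    refine ⟨convex_univ, ?_⟩
    intro a _ b _ p q hp hq hpq
    have := hconv.2 (Set.mem_univ (x + a • (y - x))) (Set.mem_univ (x + b • (y - x))) hp hq hpq
    have e : x + (p • a + q • b) • (y - x)
        = p • (x + a • (y - x)) + q • (x + b • (y - x)) := by
      have hx : x = (p + q) • x := by rw [hpq, one_smul]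
      nth_rewrite 1 [hx]
      simp only [smul_eq_mul]
      module
    simp only [e]
    exact this
  have := hc.le_slope_of_hasDerivAt (Set.mem_univ 0) (Set.mem_univ 1) one_pos hd
  simp [slope_def_field] at this
  linarith

lemma igd_descent [CompleteSpace E] (f : E → ℝ) (g : E → E) (L : ℝ)
    (hgrad : ∀ x, HasGradientAt f (g x) x)
    (hsm : ∀ x y, ‖g x - g y‖ ≤ L * ‖x - y‖) (x y : E) :
    f y ≤ f x + inner ℝ (g x) (y - x) + L / 2 * ‖y - x‖ ^ 2 := by
  set v := y - x with hv
  have hd := igd_line_deriv f g hgrad x v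
  have hB : ∀ t : ℝ, HasDerivAt
      (fun s : ℝ => f x + s * inner ℝ (g x) v + L / 2 * ‖v‖ ^ 2 * s ^ 2)
      (inner ℝ (g x) v + L * ‖v‖ ^ 2 * t) t := by
    intro t
    have h1 := (((hasDerivAt_id t).mul_const (inner ℝ (g x) v)).const_add (f x)).add
      (((hasDerivAt_id t).pow 2).const_mul (L / 2 * ‖v‖ ^ 2))
    exact h1.congr_deriv (by simp; ring)
  have key := image_le_of_deriv_right_le_deriv_boundary
    (f := fun s : ℝ => f (x + s • v)) (a := 0) (b := 1)
    (fun t _ => (hd t).continuousAt.continuousWithinAt)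
    (fun t _ => (hd t).hasDerivWithinAt)
    (B := fun s : ℝ => f x + s * inner ℝ (g x) v + L / 2 * ‖v‖ ^ 2 * s ^ 2)
    (by simp)
    (fun t _ => (hB t).continuousAt.continuousWithinAt)
    (fun t _ => (hB t).hasDerivWithinAt)
    (by
      intro t ht
      have h1 : inner ℝ (g (x + t • v) - g x) v ≤ ‖g (x + t • v) - g x‖ * ‖v‖ :=
        real_inner_le_norm _ _
      have h2 := hsm (x + t • v) x
      rw [add_sub_cancel_left, norm_smul, Real.norm_of_nonneg ht.1] at h2
      rw [inner_sub_left] at h1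
      have h3 := mul_le_mul_of_nonneg_right h2 (norm_nonneg v)
      nlinarith)
    (Set.right_mem_Icc.2 zero_le_one)
  simp [hv] at key
  linarith

lemma igd_coco [CompleteSpace E] (f : E → ℝ) (g : E → E) (L : ℝ) (hL : 0 < L)
    (hconv : ConvexOn ℝ Set.univ f)
    (hgrad : ∀ x, HasGradientAt f (g x) x)
    (hsm : ∀ x y, ‖g x - g y‖ ≤ L * ‖x - y‖) (x y : E) :
    f x + inner ℝ (g x) (y - x) + 1 / (2 * L) * ‖g x - g y‖ ^ 2 ≤ f y := by
  set u := g x - g y with hu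
  have h1 := igd_first_order f g hconv hgrad x (y + (1 / L) • u)
  have h2 := igd_descent f g L hgrad hsm y (y + (1 / L) • u)
  have e1 : y + (1 / L) • u - x = (y - x) + (1 / L) • u := by abel
  rw [e1, inner_add_right, inner_smul_right] at h1
  rw [add_sub_cancel_left, inner_smul_right, norm_smul, Real.norm_of_nonneg (by positivity)] at h2
  have h3 : inner ℝ (g x) u - inner ℝ (g y) u = ‖u‖ ^ 2 := by
    rw [← inner_sub_left, ← hu, real_inner_self_eq_norm_sq]
  have e2 : L / 2 * (1 / L * ‖u‖) ^ 2 = 1 / (2 * L) * ‖u‖ ^ 2 := by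
    field_simp
  have e3 : 1 / L * inner ℝ (g x) u - 1 / L * inner ℝ (g y) u = 2 * (1 / (2 * L) * ‖u‖ ^ 2) := by
    rw [← mul_sub, h3]; field_simp
  linarith

lemma igd_young (a b c : E) (α β : ℝ) (hα : 0 < α) (hβ : 0 < β) (h : 1 / α + 1 / β ≤ 1 / 2) :
    ‖a + b + c‖ ^ 2 ≤ β * ‖a‖ ^ 2 + α * ‖b‖ ^ 2 + 2 * ‖c‖ ^ 2 := by
  have h0 : ‖a + b + c‖ ≤ ‖a‖ + ‖b‖ + ‖c‖ := norm_add₃_le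
  have h1 : ‖a + b + c‖ ^ 2 ≤ (‖a‖ + ‖b‖ + ‖c‖) ^ 2 := by gcongr
  have h2 : (‖a‖ + ‖b‖) ^ 2 ≤ (β * ‖a‖ ^ 2 + α * ‖b‖ ^ 2) * (1 / α + 1 / β) := by
    have : (β * ‖a‖ ^ 2 + α * ‖b‖ ^ 2) * (1 / α + 1 / β) - (‖a‖ + ‖b‖) ^ 2
        = (β * ‖a‖ - α * ‖b‖) ^ 2 / (α * β) := by
      field_simp; ring
    have h3 : 0 ≤ (β * ‖a‖ - α * ‖b‖) ^ 2 / (α * β) := by positivity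
    linarith
  have h3 : (β * ‖a‖ ^ 2 + α * ‖b‖ ^ 2) * (1 / α + 1 / β)
      ≤ (β * ‖a‖ ^ 2 + α * ‖b‖ ^ 2) * (1 / 2) := by gcongr
  nlinarith [sq_nonneg (‖a‖ + ‖b‖ - ‖c‖)]

lemma igd_norm_sum (T t : ℕ) (v : ℕ → E) :
    ‖∑ s ∈ Finset.Ico t T, v s‖ ^ 2 ≤ T * ∑ s ∈ Finset.range T, ‖v s‖ ^ 2 := by
  have h1 : ‖∑ s ∈ Finset.Ico t T, v s‖ ≤ ∑ s ∈ Finset.range T, ‖v s‖ :=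
    (norm_sum_le _ _).trans (Finset.sum_le_sum_of_subset_of_nonneg
      (by intro i hi; simp at hi ⊢; omega) (fun _ _ _ => norm_nonneg _))
  have h2 := sq_sum_le_card_mul_sum_sq (s := Finset.range T) (f := fun s => ‖v s‖)
  rw [Finset.card_range] at h2
  exact (pow_le_pow_left₀ (norm_nonneg _) h1 2).trans h2

lemma igd_epoch [CompleteSpace E] (T : ℕ) (L : ℝ) (hL : 0 < L)
    (f : ℕ → E → ℝ) (g : ℕ → E → E)
    (hconv : ∀ t, ConvexOn ℝ Set.univ (f t))
    (hgrad : ∀ t x, HasGradientAt (f t) (g t x) x)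
    (hsm : ∀ t x y, ‖g t x - g t y‖ ≤ L * ‖x - y‖)
    (xs : E) (hxs : ∑ t ∈ Finset.range T, g t xs = 0)
    (α β : ℝ) (hα : 0 < α) (hβ : 0 < β) (hαβ : 1 / α + 1 / β ≤ 1 / 2)
    (η : ℝ) (hη : 0 < η) (hη2 : β * (η * T * L) ^ 2 ≤ 1)
    (y : ℕ → E) (hy : ∀ t < T, y (t + 1) = y t - η • g t (y t)) (z : E) :
    2 * η * ∑ t ∈ Finset.range T, (f t (y T) - f t z) ≤
      ‖y 0 - z‖ ^ 2 - ‖y T - z‖ ^ 2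
        + 2 * η * (α / β) * ∑ t ∈ Finset.range T, (f t z - f t xs)
        + 2 * η ^ 3 * L * T ^ 2 * ∑ t ∈ Finset.range T, ‖g t xs‖ ^ 2 := by
  set A := ∑ t ∈ Finset.range T, ‖g t (y t) - g t z‖ ^ 2 with hA
  set B := ∑ t ∈ Finset.range T, ‖g t z - g t xs‖ ^ 2 with hB
  set C := ∑ t ∈ Finset.range T, ‖g t xs‖ ^ 2 with hC
  -- tail formula
  have tail : ∀ t ≤ T, y t - y T = η • ∑ s ∈ Finset.Ico t T, g s (y s) := by
    intro t ht
    induction ht using Nat.decreasingInduction with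
    | self => simp
    | of_succ k hk ih =>
      rw [Finset.sum_eq_sum_Ico_succ_bot hk, smul_add, ← ih, hy k hk]
      abel
  have tailb : ∀ t ∈ Finset.range T, ‖y T - y t‖ ^ 2
      ≤ η ^ 2 * (β * (T * A) + α * (T * B) + 2 * (T * C)) := by
    intro t ht
    rw [norm_sub_rev, tail t (Finset.mem_range.1 ht).le, norm_smul, mul_pow,
      Real.norm_of_nonneg hη.le]
    have e : ∑ s ∈ Finset.Ico t T, g s (y s) = ∑ s ∈ Finset.Ico t T, (g s (y s) - g s z)
        + ∑ s ∈ Finset.Ico t T, (g s z - g s xs) + ∑ s ∈ Finset.Ico t T, g s xs := by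
      rw [← Finset.sum_add_distrib, ← Finset.sum_add_distrib]
      refine Finset.sum_congr rfl fun s _ => by abel
    rw [e]
    have h := igd_young (∑ s ∈ Finset.Ico t T, (g s (y s) - g s z))
      (∑ s ∈ Finset.Ico t T, (g s z - g s xs)) (∑ s ∈ Finset.Ico t T, g s xs) α β hα hβ hαβ
    refine mul_le_mul_of_nonneg_left (h.trans ?_) (by positivity)
    gcongr
    · exact igd_norm_sum T t _
    · exact igd_norm_sum T t _
    · exact igd_norm_sum T t _
  have tails : ∑ t ∈ Finset.range T, ‖y T - y t‖ ^ 2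
      ≤ T * (η ^ 2 * (β * (T * A) + α * (T * B) + 2 * (T * C))) := by
    have := Finset.sum_le_card_nsmul _ _ _ tailb
    simpa using this
  -- Bregman bound for B
  have hBle : B ≤ 2 * L * ∑ t ∈ Finset.range T, (f t z - f t xs) := by
    have h1 : ∀ t ∈ Finset.range T, ‖g t z - g t xs‖ ^ 2
        ≤ 2 * L * (f t z - f t xs - inner ℝ (g t xs) (z - xs)) := by
      intro t _
      have := igd_coco (f t) (g t) L hL (hconv t) (hgrad t) (hsm t) xs z
      rw [norm_sub_rev] at this
      have h2 : 1 / (2 * L) * ‖g t z - g t xs‖ ^ 2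
        ≤ f t z - f t xs - inner ℝ (g t xs) (z - xs) := by linarith
      have h3 := mul_le_mul_of_nonneg_left h2 (by positivity : (0 : ℝ) ≤ 2 * L)
      refine le_trans (le_of_eq ?_) h3
      field_simp
    have h2 := Finset.sum_le_sum h1
    rw [← Finset.mul_sum, Finset.sum_sub_distrib, ← sum_inner, hxs, inner_zero_left, sub_zero] at h2
    exact h2
  have hA0 : 0 ≤ A := Finset.sum_nonneg fun _ _ => by positivity
  have hB0 : 0 ≤ B := Finset.sum_nonneg fun _ _ => by positivity
  -- per-component inequality
  have hcomp : ∀ t ∈ Finset.range T, f t (y T) - f t z ≤ inner ℝ (g t (y t)) (y T - z)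
      + L / 2 * ‖y T - y t‖ ^ 2 - 1 / (2 * L) * ‖g t (y t) - g t z‖ ^ 2 := by
    intro t _
    have h1 := igd_descent (f t) (g t) L (hgrad t) (hsm t) (y t) (y T)
    have h2 := igd_coco (f t) (g t) L hL (hconv t) (hgrad t) (hsm t) (y t) z
    have e : y T - z = (y T - y t) - (z - y t) := by abel
    rw [e, inner_sub_right]
    linarith
  have hsum := Finset.sum_le_sum hcomp
  rw [Finset.sum_sub_distrib (s := Finset.range T) (f := fun t => inner ℝ (g t (y t)) (y T - z)
      + L / 2 * ‖y T - y t‖ ^ 2), Finset.sum_add_distrib, ← Finset.mul_sum, ← Finset.mul_sum,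
      ← sum_inner, ← hA] at hsum
  set S := ∑ t ∈ Finset.range T, g t (y t) with hS
  have h0 : y 0 - y T = η • S := by
    have := tail 0 (Nat.zero_le _)
    rwa [← Finset.range_eq_Ico] at this
  have hinner : 2 * η * inner ℝ S (y T - z) ≤ ‖y 0 - z‖ ^ 2 - ‖y T - z‖ ^ 2 := by
    have e : y 0 - z = η • S + (y T - z) := by rw [← h0]; abel
    rw [e, norm_add_sq_real, inner_smul_left]
    simp
    nlinarith [sq_nonneg ‖η • S‖]
  have hmul := mul_le_mul_of_nonneg_left hsum (by positivity : (0 : ℝ) ≤ 2 * η)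
  have htm := mul_le_mul_of_nonneg_left tails (by positivity : (0 : ℝ) ≤ η * L)
  -- coefficient of A
  have hcA : η * L * (T * (η ^ 2 * (β * (T * A)))) ≤ η / L * A := by
    have : η * L * (T * (η ^ 2 * (β * (T * A)))) = (η / L * A) * (β * (η * T * L) ^ 2) := by
      field_simp
    rw [this]
    exact mul_le_of_le_one_right (by positivity) hη2
  have hcB : η * L * (T * (η ^ 2 * (α * (T * B))))
      ≤ 2 * η * (α / β) * ∑ t ∈ Finset.range T, (f t z - f t xs) := by
    have e : η * L * (T * (η ^ 2 * (α * (T * B))))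
        = (η / L * (α / β) * B) * (β * (η * T * L) ^ 2) := by
      field_simp
    rw [e]
    refine (mul_le_of_le_one_right (by positivity) hη2).trans ?_
    have := mul_le_mul_of_nonneg_left hBle (by positivity : 0 ≤ η / L * (α / β))
    refine this.trans (le_of_eq ?_)
    field_simp
  have hAe : 2 * η * (1 / (2 * L) * A) = η / L * A := by field_simp
  nlinarith

end helpers

section weights

/-- Weights of the last-iterate argument. -/
noncomputable def igdP (p : ℝ) (n : ℕ) : ℝ := ∏ m ∈ Finset.range n, (1 + p / ((m : ℝ) + 1))

lemma igdP_succ (p : ℝ) (n : ℕ) : igdP p (n + 1) = igdP p n * (1 + p / ((n : ℝ) + 1)) := by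
  unfold igdP; rw [Finset.prod_range_succ]

lemma igdP_pos (p : ℝ) (hp : 0 ≤ p) (n : ℕ) : 0 < igdP p n :=
  Finset.prod_pos fun m _ => by positivity

lemma igdP_ge (p : ℝ) (hp : 0 ≤ p) (hp1 : p ≤ 1) (n : ℕ) : ((n : ℝ) + 1) ^ p ≤ igdP p n := by
  induction n with
  | zero => simp [igdP]
  | succ n ih =>
    rw [igdP_succ]
    have h1 : (0 : ℝ) < (n : ℝ) + 1 := by positivity
    have e : ((n + 1 : ℕ) : ℝ) + 1 = ((n : ℝ) + 1) * (1 + 1 / ((n : ℝ) + 1)) := by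
      push_cast; field_simp
    rw [e, Real.mul_rpow h1.le (by positivity)]
    have h2 := rpow_one_add_le_one_add_mul_self (s := 1 / ((n : ℝ) + 1)) (p := p)
      (by have : (0 : ℝ) ≤ 1 / ((n : ℝ) + 1) := by positivity
          linarith) hp hp1
    rw [mul_one_div] at h2
    exact mul_le_mul ih h2 (by positivity) (igdP_pos p hp n).le

lemma igdP_sum (p q : ℝ) (hp : 0 ≤ p) (hq : 0 < q) (hpq : p + q = 1) (n : ℕ) :
    ∑ j ∈ Finset.range n, 1 / igdP p j ≤ (1 / q) * (n : ℝ) ^ q := by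
  induction n with
  | zero => simp [hq.ne']
  | succ n ih =>
    rw [Finset.sum_range_succ]
    have h1 : (0 : ℝ) < (n : ℝ) + 1 := by positivity
    have h2 : 1 / igdP p n ≤ 1 / ((n : ℝ) + 1) ^ p := by
      have := igdP_ge p hp (by linarith) n
      gcongr
    have h3 := rpow_one_add_le_one_add_mul_self (s := -(1 / ((n : ℝ) + 1))) (p := q)
      (by have : 1 / ((n : ℝ) + 1) ≤ 1 := by
            rw [div_le_one h1]; linarith [(Nat.cast_nonneg n : (0 : ℝ) ≤ n)]
          linarith) hq.le (by linarith)
    have e : (n : ℝ) = ((n : ℝ) + 1) * (1 + -(1 / ((n : ℝ) + 1))) := by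
      field_simp; ring
    have hle : (n : ℝ) ^ q ≤ ((n : ℝ) + 1) ^ q * (1 + q * -(1 / ((n : ℝ) + 1))) := by
      have h4 : 0 ≤ 1 + -(1 / ((n : ℝ) + 1)) := by
        have : 1 / ((n : ℝ) + 1) ≤ 1 := by
          rw [div_le_one h1]; linarith [(Nat.cast_nonneg n : (0 : ℝ) ≤ n)]
        linarith
      calc (n : ℝ) ^ q = (((n : ℝ) + 1) * (1 + -(1 / ((n : ℝ) + 1)))) ^ q := by rw [← e]
        _ = ((n : ℝ) + 1) ^ q * (1 + -(1 / ((n : ℝ) + 1))) ^ q := Real.mul_rpow h1.le h4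
        _ ≤ _ := by gcongr
    have e2 : ((n : ℝ) + 1) ^ q / ((n : ℝ) + 1) = 1 / ((n : ℝ) + 1) ^ p := by
      rw [div_eq_div_iff h1.ne' (by positivity), ← Real.rpow_add h1, add_comm q p, hpq,
        Real.rpow_one, one_mul]
    have e3 : (1 / q) * (((n : ℝ) + 1) ^ q * (1 + q * -(1 / ((n : ℝ) + 1))))
        = (1 / q) * ((n : ℝ) + 1) ^ q - ((n : ℝ) + 1) ^ q / ((n : ℝ) + 1) := by
      field_simp
      ring
    have h5 := mul_le_mul_of_nonneg_left hle (by positivity : 0 ≤ 1 / q)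
    rw [e3, e2] at h5
    push_cast
    linarith

end weights

section lastiterate

variable {E : Type*} [NormedAddCommGroup E] [InnerProductSpace ℝ E]

lemma igd_potential (F : E → ℝ) (hF : ConvexOn ℝ Set.univ F) (xs : E) (M B c : ℝ)
    (hM : 0 ≤ M) (hc : 0 < c) (N : ℕ) (x : ℕ → E)
    (hstep : ∀ k < N + 1, ∀ z, F (x (k + 1)) - F z ≤ M * (‖x k - z‖ ^ 2 - ‖x (k + 1) - z‖ ^ 2)
      + c * (F z - F xs) + B) (k : ℕ) :
    ∀ n, k + n = N → ∃ z, 1 / igdP (1 / (1 + c)) n *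
        (M * ‖x k - z‖ ^ 2 + (1 + c) * ((n : ℝ) + 1) * (F z - F xs))
      ≤ 1 / igdP (1 / (1 + c)) N * (M * ‖x 0 - xs‖ ^ 2)
        + B * ∑ j ∈ Finset.range k, 1 / igdP (1 / (1 + c)) (N - j) := by
  have hp : 0 ≤ 1 / (1 + c) := by positivity
  induction k with
  | zero =>
    intro n hn
    refine ⟨xs, ?_⟩
    have : n = N := by omega
    subst this
    simp
  | succ k ih =>
    intro n hn
    obtain ⟨z, hz⟩ := ih (n + 1) (by omega)
    rw [Finset.sum_range_succ]
    have hNk : N - k = n + 1 := by omega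
    rw [hNk]
    have hs := hstep k (by omega) z
    have hPn := igdP_pos (1 / (1 + c)) hp n
    have hPn1 := igdP_pos (1 / (1 + c)) hp (n + 1)
    set θ : ℝ := 1 / (1 + 1 / (1 + c) / ((n : ℝ) + 1)) with hθ
    have hθ0 : 0 < θ := by positivity
    have hθ1 : θ ≤ 1 := by
      rw [hθ, div_le_one (by positivity)]
      have : 0 ≤ 1 / (1 + c) / ((n : ℝ) + 1) := by positivity
      linarith
    have hv : 1 / igdP (1 / (1 + c)) (n + 1) = 1 / igdP (1 / (1 + c)) n * θ := by
      rw [igdP_succ, hθ]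
      field_simp
    have hk : (1 + c) * ((n : ℝ) + 1) * (1 - θ) = θ := by
      rw [hθ]; field_simp; ring
    set r := 1 / igdP (1 / (1 + c)) n with hr
    have hr0 : 0 < r := by positivity
    rw [hv] at hz ⊢
    refine ⟨θ • z + (1 - θ) • x (k + 1), ?_⟩
    have hnorm : ‖x (k + 1) - (θ • z + (1 - θ) • x (k + 1))‖ ^ 2 ≤ θ * ‖x (k + 1) - z‖ ^ 2 := by
      have e : x (k + 1) - (θ • z + (1 - θ) • x (k + 1)) = θ • (x (k + 1) - z) := by module
      rw [e, norm_smul, Real.norm_of_nonneg hθ0.le, mul_pow]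
      have : θ ^ 2 ≤ θ := by nlinarith
      gcongr
    have hcv := hF.2 (Set.mem_univ z) (Set.mem_univ (x (k + 1))) hθ0.le
      (by linarith : (0 : ℝ) ≤ 1 - θ) (by ring)
    simp only [smul_eq_mul] at hcv
    have h1 : M * ‖x (k + 1) - (θ • z + (1 - θ) • x (k + 1))‖ ^ 2
        ≤ M * (θ * ‖x (k + 1) - z‖ ^ 2) := by gcongr
    have h2 : (1 + c) * ((n : ℝ) + 1) * (F (θ • z + (1 - θ) • x (k + 1)) - F xs)
        ≤ (1 + c) * ((n : ℝ) + 1) * (θ * (F z - F xs)) + θ * (F (x (k + 1)) - F xs) := by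
      have h3 : F (θ • z + (1 - θ) • x (k + 1)) - F xs
          ≤ θ * (F z - F xs) + (1 - θ) * (F (x (k + 1)) - F xs) := by linarith
      have h4 := mul_le_mul_of_nonneg_left h3
        (by positivity : 0 ≤ (1 + c) * ((n : ℝ) + 1))
      refine h4.trans (le_of_eq ?_)
      linear_combination (F (x (k + 1)) - F xs) * hk
    have h5 := mul_le_mul_of_nonneg_left (add_le_add h1 h2) hr0.le
    have h6 := mul_le_mul_of_nonneg_left hs (mul_pos hr0 hθ0).le
    push_cast at hz
    linarith

lemma igd_last (F : E → ℝ) (hF : ConvexOn ℝ Set.univ F) (xs : E) (M B c : ℝ)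
    (hM : 0 ≤ M) (hB : 0 ≤ B) (hc : 0 < c) (K : ℕ) (hK : 1 ≤ K) (x : ℕ → E)
    (hstep : ∀ k < K, ∀ z, F (x (k + 1)) - F z ≤ M * (‖x k - z‖ ^ 2 - ‖x (k + 1) - z‖ ^ 2)
      + c * (F z - F xs) + B) :
    F (x K) - F xs ≤ M * ‖x 0 - xs‖ ^ 2 / (K : ℝ) ^ (1 / (1 + c))
      + B * (1 + 1 / c) * (K : ℝ) ^ (c / (1 + c)) := by
  obtain ⟨N, rfl⟩ : ∃ N, K = N + 1 := ⟨K - 1, by omega⟩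
  have hp : 0 ≤ 1 / (1 + c) := by positivity
  have hp1 : 1 / (1 + c) ≤ 1 := by rw [div_le_one (by positivity)]; linarith
  obtain ⟨z, hz⟩ := igd_potential F hF xs M B c hM hc N x hstep N 0 rfl
  have hs := hstep N (by omega) z
  have hsum : ∑ j ∈ Finset.range (N + 1), 1 / igdP (1 / (1 + c)) (N - j)
      ≤ (1 + 1 / c) * ((N + 1 : ℕ) : ℝ) ^ (c / (1 + c)) := by
    have h1 := Finset.sum_range_reflect (fun j => 1 / igdP (1 / (1 + c)) j) (N + 1)
    simp only [Nat.add_sub_cancel] at h1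
    rw [h1]
    refine (igdP_sum (1 / (1 + c)) (c / (1 + c)) hp (by positivity) (by field_simp) (N + 1)).trans
      (le_of_eq ?_)
    congr 1
    field_simp
    try ring
  have hge := igdP_ge (1 / (1 + c)) hp hp1 N
  have hD : 1 / igdP (1 / (1 + c)) N * (M * ‖x 0 - xs‖ ^ 2)
      ≤ M * ‖x 0 - xs‖ ^ 2 / ((N + 1 : ℕ) : ℝ) ^ (1 / (1 + c)) := by
    rw [one_div_mul_eq_div]
    push_cast
    gcongr
  have hBs := mul_le_mul_of_nonneg_left hsum hB
  rw [Finset.sum_range_succ] at hBs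
  have hP0 : igdP (1 / (1 + c)) 0 = 1 := by simp [igdP]
  simp only [Nat.sub_self, hP0] at hBs hz
  have : 0 ≤ M * ‖x (N + 1) - z‖ ^ 2 := by positivity
  norm_num at hz hBs hs hD ⊢
  linarith

end lastiterate

/-- Shuffle-once IGD, expected last-iterate bound (Corollary 2.5).
One uniformly random permutation `π` of the `T` components is used in every epoch;
the expectation is the average over all `T!` permutations. -/
theorem shuffled_igd_last_iterate_bound
    (d T K : ℕ) (hT : 0 < T) (hK : 1 ≤ K) (L : ℝ) (hL : 0 < L)
    (f : Fin T → EuclideanSpace ℝ (Fin d) → ℝ)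
    (g : Fin T → EuclideanSpace ℝ (Fin d) → EuclideanSpace ℝ (Fin d))
    (hconv : ∀ t, ConvexOn ℝ Set.univ (f t))
    (hgrad : ∀ t x, HasGradientAt (f t) (g t x) x)
    (hsmooth : ∀ t x y, ‖g t x - g t y‖ ≤ L * ‖x - y‖)
    (F : EuclideanSpace ℝ (Fin d) → ℝ)
    (hF : F = fun x => (1 / (T : ℝ)) * ∑ t : Fin T, f t x)
    (xstar : EuclideanSpace ℝ (Fin d))
    (hmin : ∀ x, F xstar ≤ F x)
    (σsq : ℝ) (hσsq : σsq = (1 / (T : ℝ)) * ∑ t : Fin T, ‖g t xstar‖ ^ 2)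
    (α β : ℝ) (hα : 0 < α) (hβ : 0 < β) (hαβ : 1 / α + 1 / β ≤ 1 / 2)
    (η : ℝ) (hη : 0 < η) (hηle : η ≤ 1 / (Real.sqrt β * T * L))
    (x0 : EuclideanSpace ℝ (Fin d))
    (x : Equiv.Perm (Fin T) → ℕ → EuclideanSpace ℝ (Fin d))
    (y : Equiv.Perm (Fin T) → ℕ → ℕ → EuclideanSpace ℝ (Fin d))
    (hx0 : ∀ π, x π 0 = x0)
    (hy0 : ∀ π, ∀ k < K, y π k 0 = x π k)
    (hupd : ∀ π, ∀ k < K, ∀ t : Fin T,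
      y π k (t.val + 1) = y π k t.val - η • g (π t) (y π k t.val))
    (hxk : ∀ π, ∀ k < K, x π (k + 1) = y π k T) :
    (∑ π : Equiv.Perm (Fin T), (F (x π K) - F xstar)) / (Nat.factorial T : ℝ) ≤
      Real.exp 1 * η ^ 2 * (T : ℝ) ^ 2 * σsq * L * (1 + β / α)
          * (K : ℝ) ^ ((α / β) / (1 + α / β))
        + Real.exp 1 * ‖x0 - xstar‖ ^ 2
          / (2 * T * η * (K : ℝ) ^ ((1 : ℝ) / (1 + α / β))) := by
  have hTr : (0 : ℝ) < T := by exact_mod_cast hT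
  have : NeZero T := ⟨hT.ne'⟩
  have hc : 0 < α / β := by positivity
  -- the averaged objective is convex
  have hFconv : ConvexOn ℝ Set.univ F := by
    refine ⟨convex_univ, ?_⟩
    intro a _ b _ p q hp hq hpq
    have h1 : ∑ t : Fin T, f t (p • a + q • b) ≤ ∑ t : Fin T, (p * f t a + q * f t b) :=
      Finset.sum_le_sum fun t _ => (hconv t).2 (Set.mem_univ a) (Set.mem_univ b) hp hq hpq
    rw [Finset.sum_add_distrib, ← Finset.mul_sum, ← Finset.mul_sum] at h1
    have h2 := mul_le_mul_of_nonneg_left h1 (by positivity : 0 ≤ 1 / (T : ℝ))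
    simp only [hF, smul_eq_mul]
    linarith
  -- the gradient vanishes at the minimizer
  have hzero : ∑ t : Fin T, g t xstar = 0 := by
    have hd : HasFDerivAt (fun u => ∑ t : Fin T, f t u)
        (∑ t : Fin T, InnerProductSpace.toDual ℝ _ (g t xstar)) xstar :=
      HasFDerivAt.fun_sum fun t _ => (hgrad t xstar).hasFDerivAt
    have hm : IsLocalMin (fun u => ∑ t : Fin T, f t u) xstar := by
      refine Filter.Eventually.of_forall fun u => ?_
      have := hmin u
      simp only [hF] at this
      exact le_of_mul_le_mul_left this (by positivity)
    have h0 := hm.hasFDerivAt_eq_zero hd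
    rw [← map_sum] at h0
    exact (LinearIsometryEquiv.map_eq_zero_iff _).1 h0
  have hη2 : β * (η * T * L) ^ 2 ≤ 1 := by
    have hs : 0 < Real.sqrt β := Real.sqrt_pos.2 hβ
    have h1 : η * (Real.sqrt β * T * L) ≤ 1 := by
      rwa [le_div_iff₀ (by positivity)] at hηle
    have h2 : (η * (Real.sqrt β * T * L)) ^ 2 ≤ 1 := pow_le_one₀ (by positivity) h1
    have h3 : (η * (Real.sqrt β * T * L)) ^ 2 = Real.sqrt β ^ 2 * (η * T * L) ^ 2 := by ring
    rw [h3, Real.sq_sqrt hβ.le] at h2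
    exact h2
  have hσ0 : 0 ≤ σsq := by
    rw [hσsq]
    exact mul_nonneg (by positivity) (Finset.sum_nonneg fun _ _ => by positivity)
  -- deterministic bound for each permutation
  have hdet : ∀ π : Equiv.Perm (Fin T), F (x π K) - F xstar ≤
      Real.exp 1 * η ^ 2 * (T : ℝ) ^ 2 * σsq * L * (1 + β / α)
          * (K : ℝ) ^ ((α / β) / (1 + α / β))
        + Real.exp 1 * ‖x0 - xstar‖ ^ 2
          / (2 * T * η * (K : ℝ) ^ ((1 : ℝ) / (1 + α / β))) := by
    intro π
    have hsumπ : ∀ {M : Type} [AddCommMonoid M] (h : Fin T → M),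
        ∑ t ∈ Finset.range T, h (π (Fin.ofNat T t)) = ∑ t : Fin T, h t := by
      intro M _ h
      rw [Finset.sum_range]
      rw [← Equiv.sum_comp π h]
      refine Finset.sum_congr rfl fun i _ => ?_
      congr 2
      ext
      simp [Nat.mod_eq_of_lt i.2]
    have hstep : ∀ k < K, ∀ z, F (x π (k + 1)) - F z
        ≤ 1 / (2 * η * T) * (‖x π k - z‖ ^ 2 - ‖x π (k + 1) - z‖ ^ 2)
          + α / β * (F z - F xstar) + η ^ 2 * (T : ℝ) ^ 2 * σsq * L := by
      intro k hk z
      have h := igd_epoch T L hL (fun t => f (π (Fin.ofNat T t))) (fun t => g (π (Fin.ofNat T t)))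
        (fun t => hconv _) (fun t => hgrad _) (fun t => hsmooth _) xstar
        ((hsumπ fun t => g t xstar).trans hzero) α β hα hβ hαβ η hη hη2 (y π k)
        (by
          intro t ht
          have h1 := hupd π k hk ⟨t, ht⟩
          have h2 : Fin.ofNat T t = ⟨t, ht⟩ := by
            ext; simp [Nat.mod_eq_of_lt ht]
          simp only [h2]
          exact h1) z
      have e1 := hsumπ (fun t => f t (y π k T) - f t z)
      have e2 := hsumπ (fun t => f t z - f t xstar)
      have e3 := hsumπ (fun t => ‖g t xstar‖ ^ 2)
      have hFs : ∀ u w, ∑ t : Fin T, (f t u - f t w) = T * (F u - F w) := by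
        intro u w
        rw [Finset.sum_sub_distrib, hF]
        field_simp
      have hσs : ∑ t : Fin T, ‖g t xstar‖ ^ 2 = T * σsq := by
        rw [hσsq]; field_simp
      rw [e1, e2, e3, hFs, hFs, hσs, hy0 π k hk, ← hxk π k hk] at h
      have hpos : 0 < 2 * η * (T : ℝ) := by positivity
      refine le_of_mul_le_mul_left (a := 2 * η * (T : ℝ)) ?_ hpos
      have e4 : 2 * η * (T : ℝ) * (1 / (2 * η * T) * (‖x π k - z‖ ^ 2 - ‖x π (k + 1) - z‖ ^ 2)
          + α / β * (F z - F xstar) + η ^ 2 * (T : ℝ) ^ 2 * σsq * L)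
          = (‖x π k - z‖ ^ 2 - ‖x π (k + 1) - z‖ ^ 2)
          + 2 * η * (α / β) * (T * (F z - F xstar))
          + 2 * η ^ 3 * L * T ^ 2 * (T * σsq) := by
        field_simp
      rw [e4]
      linarith
    have hl := igd_last F hFconv xstar (1 / (2 * η * T)) (η ^ 2 * (T : ℝ) ^ 2 * σsq * L) (α / β)
      (by positivity) (by positivity) hc K hK (x π) hstep
    rw [hx0] at hl
    have he : 1 ≤ Real.exp 1 := Real.one_le_exp zero_le_one
    have hKr : (0 : ℝ) < K := by exact_mod_cast hK
    set U := (K : ℝ) ^ ((1 : ℝ) / (1 + α / β)) with hU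
    set V := (K : ℝ) ^ ((α / β) / (1 + α / β)) with hV
    have hU0 : 0 < U := Real.rpow_pos_of_pos hKr _
    have hV0 : 0 < V := Real.rpow_pos_of_pos hKr _
    have e5 : 1 / (α / β) = β / α := one_div_div α β
    rw [e5] at hl
    have hR0 : 0 ≤ 1 / (2 * η * T) * ‖x0 - xstar‖ ^ 2 / U
      + η ^ 2 * (T : ℝ) ^ 2 * σsq * L * (1 + β / α) * V := by positivity
    refine hl.trans ((le_mul_of_one_le_left hR0 he).trans (le_of_eq ?_))
    field_simp
    try ring
  have hcard : (∑ π : Equiv.Perm (Fin T), (F (x π K) - F xstar)) ≤ (Nat.factorial T : ℝ) *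
      (Real.exp 1 * η ^ 2 * (T : ℝ) ^ 2 * σsq * L * (1 + β / α)
          * (K : ℝ) ^ ((α / β) / (1 + α / β))
        + Real.exp 1 * ‖x0 - xstar‖ ^ 2
          / (2 * T * η * (K : ℝ) ^ ((1 : ℝ) / (1 + α / β)))) := by
    have := Finset.sum_le_card_nsmul Finset.univ _ _ fun π _ => hdet π
    rwa [Finset.card_univ, Fintype.card_perm, Fintype.card_fin, nsmul_eq_mul] at this
  rw [div_le_iff₀ (by positivity), mul_comm _ (Nat.factorial T : ℝ)]
  exact hcard
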